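/- The Hausdorff dimension of the boundary of K_l equals log(2l+1)/log(2l+2). -/

import Mathlib

open MeasureTheory

def Tl (l : ℕ) : Set ℕ :=
  {d | (Even d ∧ d ≤ 2 * l) ∨ (Odd d ∧ 2 * l + 1 ≤ d ∧ d ≤ 4 * l + 1)}

def Kl (l : ℕ) : Set ℝ :=
  {x | ∃ ε : ℕ → ℕ, (∀ i, ε i ∈ Tl l) ∧
    x = ∑' i : ℕ, (ε i : ℝ) / (2 * l + 2) ^ (i + 1)}

open Filter Topology Set
open scoped Pointwise ENNReal NNReal

noncomputable def digitExpansion (l : ℕ) (ε : ℕ → ℕ) : ℝ :=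
  ∑' i : ℕ, (ε i : ℝ) / (2 * l + 2) ^ (i + 1)

lemma Tl_le {l d : ℕ} (h : d ∈ Tl l) : d ≤ 4 * l + 1 := by
  rcases h with ⟨-, h⟩ | ⟨-, -, h⟩ <;> omega

lemma zero_mem_Tl (l : ℕ) : 0 ∈ Tl l := Or.inl ⟨Even.zero, by omega⟩

lemma hasSum_digit_bound (l : ℕ) :
    HasSum (fun i : ℕ => (4 * l + 1 : ℝ) / (2 * l + 2) ^ (i + 1)) ((4 * l + 1) / (2 * l + 1)) := by
  have hl : (0 : ℝ) ≤ l := l.cast_nonneg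
  have hlt : ((2 * l + 2 : ℝ))⁻¹ < 1 := inv_lt_one_of_one_lt₀ (by linarith)
  have h := (hasSum_geometric_of_lt_one (by positivity) hlt).mul_left ((4 * l + 1 : ℝ) / (2 * l + 2))
  have e : (4 * l + 1 : ℝ) / (2 * l + 2) * (1 - (2 * l + 2 : ℝ)⁻¹)⁻¹
      = (4 * l + 1) / (2 * l + 1) := by
    have : (1 - (2 * l + 2 : ℝ)⁻¹) = (2 * l + 1) / (2 * l + 2) := by field_simp; ring
    rw [this]; field_simp
  rw [e] at h
  refine h.congr_fun fun i => ?_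
  rw [pow_succ, inv_pow]; field_simp

lemma digit_term_le {l d : ℕ} (h : d ∈ Tl l) (i : ℕ) :
    (d : ℝ) / (2 * l + 2) ^ (i + 1) ≤ (4 * l + 1 : ℝ) / (2 * l + 2) ^ (i + 1) := by
  have : (d : ℝ) ≤ 4 * l + 1 := by exact_mod_cast Tl_le h
  gcongr

lemma summable_digits {l : ℕ} {ε : ℕ → ℕ} (h : ∀ i, ε i ∈ Tl l) :
    Summable fun i : ℕ => (ε i : ℝ) / (2 * l + 2) ^ (i + 1) :=
  (hasSum_digit_bound l).summable.of_nonneg_of_le (fun _ => by positivity)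
    fun i => digit_term_le (h i) i

lemma digitExpansion_shift {l : ℕ} {ε : ℕ → ℕ} (h : ∀ i, ε i ∈ Tl l) :
    digitExpansion l ε = (ε 0 + digitExpansion l fun i => ε (i + 1)) / (2 * l + 2) := by
  unfold digitExpansion
  rw [(summable_digits h).tsum_eq_zero_add, add_div, ← tsum_div_const]
  congr 1
  · simp
  · refine tsum_congr fun i => ?_
    rw [pow_succ _ (i + 1)]; field_simp

lemma Kl_subset_Icc (l : ℕ) : Kl l ⊆ Icc (0 : ℝ) ((4 * l + 1) / (2 * l + 1)) := by
  rintro _ ⟨ε, h, rfl⟩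
  refine ⟨tsum_nonneg fun _ => by positivity, ?_⟩
  rw [← (hasSum_digit_bound l).tsum_eq]
  exact (summable_digits h).tsum_le_tsum (fun i => digit_term_le (h i) i)
    (hasSum_digit_bound l).summable

lemma Kl_diam_lt_two (l : ℕ) : ((4 * l + 1) / (2 * l + 1) : ℝ) = 2 - 1 / (2 * l + 1) := by
  have hl : (0 : ℝ) ≤ l := l.cast_nonneg
  field_simp; ring

lemma zero_mem_Kl (l : ℕ) : (0 : ℝ) ∈ Kl l :=
  ⟨fun _ => 0, fun _ => zero_mem_Tl l, by simp⟩

lemma add_div_mem_Kl {l d : ℕ} {y : ℝ} (hd : d ∈ Tl l) (hy : y ∈ Kl l) :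
    (d + y) / (2 * l + 2) ∈ Kl l := by
  obtain ⟨ε, h, rfl⟩ := hy
  have h' : ∀ i, (fun i => Nat.casesOn i d ε : ℕ → ℕ) i ∈ Tl l := by
    rintro (_ | i)
    · exact hd
    · exact h i
  exact ⟨_, h', (digitExpansion_shift h').symm⟩

lemma exists_mul_sub_mem_Kl {l : ℕ} {x : ℝ} (hx : x ∈ Kl l) :
    ∃ d ∈ Tl l, (2 * l + 2) * x - d ∈ Kl l := by
  obtain ⟨ε, h, rfl⟩ := hx
  refine ⟨ε 0, h 0, fun i => ε (i + 1), fun i => h _, ?_⟩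
  have := digitExpansion_shift h
  unfold digitExpansion at this
  have hl : (0 : ℝ) ≤ l := l.cast_nonneg
  rw [this]; field_simp; ring

lemma isCompact_Kl (l : ℕ) : IsCompact (Kl l) := by
  have hT : IsCompact (Tl l) := ((finite_Iic (4 * l + 1)).subset fun d hd => Tl_le hd).isCompact
  have hc : IsCompact (univ.pi fun _ : ℕ => Tl l) := isCompact_univ_pi fun _ => hT
  have : Kl l = digitExpansion l '' univ.pi fun _ : ℕ => Tl l := by
    ext x; simp only [Kl, digitExpansion, mem_image, mem_ofPred_eq, mem_univ_pi, eq_comm]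
  rw [this]
  refine hc.image_of_continuousOn (continuousOn_tsum (fun i => ?_)
    (hasSum_digit_bound l).summable fun i ε hε => ?_)
  · exact ((continuous_of_discreteTopology.comp (continuous_apply i) :
      Continuous fun ε : ℕ → ℕ => ((ε i : ℕ) : ℝ)).div_const _).continuousOn
  · rw [Real.norm_of_nonneg (by positivity)]
    exact digit_term_le (hε i (mem_univ _)) i

/-- `Tl l` is a complete residue system modulo `2 * l + 2`. -/
lemma exists_eq_mul_add_mem_Tl (l : ℕ) (z : ℤ) :
    ∃ d ∈ Tl l, ∃ q : ℤ, z = (2 * l + 2) * q + d := by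
  obtain ⟨r, hr⟩ := Int.eq_ofNat_of_zero_le (Int.emod_nonneg z (b := 2 * l + 2) (by omega))
  have hlt := Int.emod_lt_of_pos z (b := 2 * l + 2) (by omega)
  have hz := Int.mul_ediv_add_emod z (2 * l + 2)
  rw [hr] at hlt hz
  rcases Nat.even_or_odd r with he | ho
  · exact ⟨r, Or.inl ⟨he, by obtain ⟨a, rfl⟩ := he; omega⟩, z / (2 * l + 2), hz.symm⟩
  · by_cases h : r = 2 * l + 1
    · exact ⟨r, Or.inr ⟨ho, by omega, by omega⟩, z / (2 * l + 2), hz.symm⟩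
    · refine ⟨r + (2 * l + 2), Or.inr ⟨?_, by omega, ?_⟩, z / (2 * l + 2) - 1, ?_⟩
      · exact ho.add_even ⟨l + 1, by ring⟩
      · obtain ⟨a, rfl⟩ := ho; omega
      · push_cast; linarith

lemma isClosed_Kl_add_intCast (l : ℕ) (S : Set ℤ) :
    IsClosed (Kl l + ((↑) : ℤ → ℝ) '' S) :=
  (Int.isClosedEmbedding_coe_real.isClosedMap _ (isClosed_discrete S)).add_left_of_isCompact
    (isCompact_Kl l)

lemma Kl_add_int_eq_univ (l : ℕ) : Kl l + ((↑) : ℤ → ℝ) '' univ = univ := by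
  have hl : (0 : ℝ) ≤ l := l.cast_nonneg
  set A := Kl l + ((↑) : ℤ → ℝ) '' univ with hA
  have hdiv : ∀ y ∈ A, y / (2 * l + 2) ∈ A := by
    rintro _ ⟨k, hk, _, ⟨z, -, rfl⟩, rfl⟩
    obtain ⟨d, hd, q, rfl⟩ := exists_eq_mul_add_mem_Tl l z
    refine ⟨_, add_div_mem_Kl hd hk, q, ⟨q, trivial, rfl⟩, ?_⟩
    push_cast; field_simp; ring
  have hpow : ∀ (n : ℕ) (m : ℤ), (m : ℝ) / (2 * l + 2) ^ n ∈ A := by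
    intro n m
    induction n with
    | zero => exact ⟨0, zero_mem_Kl l, m, ⟨m, trivial, rfl⟩, by simp⟩
    | succ n ih => rw [pow_succ, ← div_div]; exact hdiv _ ih
  have hcl : IsClosed A := isClosed_Kl_add_intCast l univ
  refine eq_univ_of_forall fun x => ?_
  rw [← hcl.closure_eq, Metric.mem_closure_iff]
  intro δ hδ
  obtain ⟨n, hn⟩ := exists_pow_lt_of_lt_one hδ
    (inv_lt_one_of_one_lt₀ (by linarith) : (2 * l + 2 : ℝ)⁻¹ < 1)
  refine ⟨_, hpow n ⌊x * (2 * l + 2) ^ n⌋, lt_of_le_of_lt ?_ hn⟩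
  have hp : (0 : ℝ) < (2 * l + 2) ^ n := by positivity
  have h1 := Int.floor_le (x * (2 * l + 2 : ℝ) ^ n)
  have h2 := Int.lt_floor_add_one (x * (2 * l + 2 : ℝ) ^ n)
  have e : x - (⌊x * (2 * l + 2 : ℝ) ^ n⌋ : ℝ) / (2 * l + 2) ^ n
      = (x * (2 * l + 2) ^ n - ⌊x * (2 * l + 2 : ℝ) ^ n⌋) / (2 * l + 2) ^ n := by field_simp
  rw [Real.dist_eq, e, abs_of_nonneg (div_nonneg (by linarith) hp.le), inv_pow, ← one_div]
  gcongr; linarith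

/-- The intersection of the tile `Kl l` with its translate by the integer `k`. -/
def tileInter (l : ℕ) (k : ℤ) : Set ℝ := {x | x ∈ Kl l ∧ x - k ∈ Kl l}

/-- The state reached from `k = ±1` along the edge `j` of the boundary graph. -/
def nextState (l : ℕ) (k : ℤ) (j : ℕ) : ℤ := if j ≤ l then k else -k

/-- The digit read from the state `k = ±1` along the edge `j` of the boundary graph. -/
def edgeDigit (l : ℕ) (k : ℤ) (j : ℕ) : ℕ :=
  if k = 1 then (if j ≤ l then 2 * l + 1 + 2 * j else 2 * j + 1)
  else (if j ≤ l then 2 * j else 2 * (j - l - 1))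

lemma nextState_eq_or {l : ℕ} {k : ℤ} (hk : k = 1 ∨ k = -1) (j : ℕ) :
    nextState l k j = 1 ∨ nextState l k j = -1 := by
  unfold nextState; split_ifs <;> omega

lemma nextState_neg (l : ℕ) (k : ℤ) (j : ℕ) : nextState l (-k) j = -nextState l k j := by
  unfold nextState; split_ifs <;> rfl

lemma edgeDigit_mem_Tl {l j : ℕ} (k : ℤ) (hj : j < 2 * l + 1) : edgeDigit l k j ∈ Tl l := by
  unfold edgeDigit
  split_ifs
  · exact Or.inr ⟨⟨l + j, by ring⟩, by omega, by omega⟩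
  · exact Or.inr ⟨⟨j, by ring⟩, by omega, by omega⟩
  · exact Or.inl ⟨⟨j, by ring⟩, by omega⟩
  · exact Or.inl ⟨⟨j - l - 1, by ring⟩, by omega⟩

lemma edgeDigit_sub_edgeDigit_neg {l : ℕ} {k : ℤ} (hk : k = 1 ∨ k = -1) (j : ℕ) :
    (edgeDigit l k j : ℤ) - edgeDigit l (-k) j = (2 * l + 2) * k - nextState l k j := by
  unfold edgeDigit nextState
  rcases hk with rfl | rfl <;> split_ifs <;> first | contradiction | (push_cast; omega)

lemma exists_edge {l d d' : ℕ} {k k' : ℤ} (hk : k = 1 ∨ k = -1) (hk' : |k'| ≤ 1)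
    (hd : d ∈ Tl l) (hd' : d' ∈ Tl l) (h : k' = (2 * l + 2) * k + d' - d) :
    ∃ j < 2 * l + 1, d = edgeDigit l k j ∧ k' = nextState l k j := by
  rw [abs_le] at hk'
  unfold edgeDigit nextState
  rcases hk with rfl | rfl
  · rcases hd with ⟨⟨a, rfl⟩, h1⟩ | ⟨⟨a, rfl⟩, h1, h2⟩
    · exfalso; omega
    rcases hd' with ⟨⟨b, rfl⟩, h3⟩ | ⟨⟨b, rfl⟩, h3, h4⟩
    swap
    · exfalso; omega
    obtain rfl | rfl : k' = 1 ∨ k' = -1 := by omega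
    · exact ⟨b, by omega, by simp [show b ≤ l by omega]; omega⟩
    · exact ⟨b + l + 1, by omega, by simp [show ¬ (b + l + 1 ≤ l) by omega]; omega⟩
  · rcases hd with ⟨⟨a, rfl⟩, h1⟩ | ⟨⟨a, rfl⟩, h1, h2⟩
    swap
    · exfalso; rcases hd' with ⟨⟨b, rfl⟩, h3⟩ | ⟨⟨b, rfl⟩, h3, h4⟩ <;> omega
    rcases hd' with ⟨⟨b, rfl⟩, h3⟩ | ⟨⟨b, rfl⟩, h3, h4⟩
    · exfalso; omega
    obtain rfl | rfl : k' = 1 ∨ k' = -1 := by omega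
    · exact ⟨a + l + 1, by omega, by simp [show ¬ (a + l + 1 ≤ l) by omega]; omega⟩
    · exact ⟨a, by omega, by simp [show a ≤ l by omega]; omega⟩

lemma exists_mul_sub_mem_tileInter {l : ℕ} {k : ℤ} (hk : k = 1 ∨ k = -1) {x : ℝ}
    (hx : x ∈ tileInter l k) :
    ∃ j < 2 * l + 1, (2 * l + 2) * x - edgeDigit l k j ∈ tileInter l (nextState l k j) := by
  obtain ⟨d, hd, hy⟩ := exists_mul_sub_mem_Kl hx.1
  obtain ⟨d', hd', hy'⟩ := exists_mul_sub_mem_Kl hx.2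
  have hdiff : ((2 * l + 2) * x - d) - ((2 * l + 2) * (x - k) - d')
      = (((2 * l + 2) * k + d' - d : ℤ) : ℝ) := by push_cast; ring
  have hl : (0 : ℝ) < 1 / (2 * l + 1) := by positivity
  have b1 := Kl_subset_Icc l hy
  have b2 := Kl_subset_Icc l hy'
  rw [Kl_diam_lt_two] at b1 b2
  have habs : |((2 * l + 2) * k + d' - d : ℤ)| ≤ 1 := by
    rw [← Int.lt_add_one_iff]
    have : |(((2 * l + 2) * k + d' - d : ℤ) : ℝ)| < 2 := by
      rw [← hdiff, abs_lt]
      constructor <;> linarith [b1.1, b1.2, b2.1, b2.2]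
    exact_mod_cast this
  obtain ⟨j, hj, hdj, hkj⟩ := exists_edge hk habs hd hd' rfl
  refine ⟨j, hj, ?_, ?_⟩
  · rwa [← hdj]
  · rw [← hdj, ← hkj, ← hdiff]
    convert hy' using 1; ring

lemma exists_cover_tileInter (l n : ℕ) (k : ℤ) (hk : k = 1 ∨ k = -1) :
    ∃ S : Finset ℝ, S.card ≤ (2 * l + 1) ^ n ∧
      tileInter l k ⊆ ⋃ a ∈ S, Icc a (a + 2 / (2 * l + 2) ^ n) := by
  classical
  induction n generalizing k with
  | zero =>
    refine ⟨{0}, by simp, fun x hx => ?_⟩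
    have b := Kl_subset_Icc l hx.1
    have hl : (0 : ℝ) < 1 / (2 * l + 1) := by positivity
    rw [Kl_diam_lt_two] at b
    simp only [Finset.mem_singleton, iUnion_iUnion_eq_left, mem_Icc]
    exact ⟨b.1, by norm_num; linarith [b.2]⟩
  | succ n ih =>
    choose S hcard hcov using fun j => ih (nextState l k j) (nextState_eq_or hk j)
    refine ⟨(Finset.range (2 * l + 1)).biUnion fun j =>
      (S j).image fun a => (edgeDigit l k j + a) / (2 * l + 2), ?_, fun x hx => ?_⟩
    · refine Finset.card_biUnion_le.trans ?_
      calc _ ≤ ∑ _j ∈ Finset.range (2 * l + 1), (2 * l + 1) ^ n :=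
            Finset.sum_le_sum fun j _ => Finset.card_image_le.trans (hcard j)
        _ = _ := by rw [Finset.sum_const, Finset.card_range, smul_eq_mul, pow_succ, mul_comm]
    · obtain ⟨j, hj, hy⟩ := exists_mul_sub_mem_tileInter hk hx
      obtain ⟨a, ha, h1, h2⟩ := mem_iUnion₂.1 (hcov j hy)
      refine mem_iUnion₂.2 ⟨(edgeDigit l k j + a) / (2 * l + 2), ?_, ?_, ?_⟩
      · exact Finset.mem_biUnion.2 ⟨j, Finset.mem_range.2 hj, Finset.mem_image_of_mem _ ha⟩
      · rw [div_le_iff₀ (by positivity)]; linarith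
      · rw [pow_succ, ← div_div, ← add_div, le_div_iff₀ (by positivity)]; linarith

lemma pow_rpow_log_div_log {l : ℕ} (n : ℕ) :
    ((2 * l + 2 : ℝ) ^ n) ^ (Real.log (2 * l + 1) / Real.log (2 * l + 2)) = (2 * l + 1) ^ n := by
  have hl : (0 : ℝ) ≤ l := l.cast_nonneg
  rw [← Real.rpow_pow_comm (by positivity)]
  congr 1
  rw [Real.rpow_def_of_pos (by positivity),
    mul_div_cancel₀ _ (Real.log_pos (by linarith)).ne', Real.exp_log (by positivity)]

lemma dimH_tileInter_le {l : ℕ} {k : ℤ} (hk : k = 1 ∨ k = -1) :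
    dimH (tileInter l k) ≤ ENNReal.ofReal (Real.log (2 * l + 1) / Real.log (2 * l + 2)) := by
  have hl : (0 : ℝ) ≤ l := l.cast_nonneg
  choose S hcard hcov using fun n => exists_cover_tileInter l n k hk
  set s := Real.log (2 * l + 1) / Real.log (2 * l + 2) with hs
  have hs0 : 0 ≤ s := div_nonneg (Real.log_nonneg (by linarith)) (Real.log_nonneg (by linarith))
  refine dimH_le_of_hausdorffMeasure_ne_top (d := s.toNNReal) (ne_top_of_le_ne_top
    (ENNReal.ofReal_ne_top (r := 2 ^ s)) ?_)
  rw [Real.coe_toNNReal _ hs0]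
  have hdiam : ∀ (n : ℕ) (a : ℝ), Metric.ediam (Icc a (a + 2 / (2 * l + 2) ^ n))
      = ENNReal.ofReal (2 / (2 * l + 2) ^ n) := fun n a => by
    rw [Real.ediam_Icc, add_sub_cancel_left]
  refine (Measure.hausdorffMeasure_le_liminf_sum s _ (l := atTop)
    (fun n : ℕ => ENNReal.ofReal (2 / (2 * l + 2) ^ n)) ?_
    (fun n (a : S n) => Icc (a : ℝ) (a + 2 / (2 * l + 2) ^ n))
    (Eventually.of_forall fun n a => (hdiam n a).le)
    (Eventually.of_forall fun n => ?_)).trans ?_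
  · rw [← ENNReal.ofReal_zero]
    refine ENNReal.tendsto_ofReal ?_
    have := (tendsto_pow_atTop_nhds_zero_of_lt_one (by positivity)
      (inv_lt_one_of_one_lt₀ (by linarith) : (2 * l + 2 : ℝ)⁻¹ < 1)).const_mul 2
    simpa [div_eq_mul_inv] using this
  · rw [iUnion_subtype]; exact hcov n
  · refine liminf_le_of_frequently_le' (Frequently.of_forall fun n => ?_)
    simp only [hdiam, Finset.sum_const, Finset.card_univ, Fintype.card_coe, nsmul_eq_mul]
    rw [ENNReal.ofReal_rpow_of_nonneg (by positivity) hs0, ← ENNReal.ofReal_natCast,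
      ← ENNReal.ofReal_mul (by positivity), Real.div_rpow (by positivity) (by positivity),
      pow_rpow_log_div_log]
    refine ENNReal.ofReal_le_ofReal ?_
    have : ((S n).card : ℝ) ≤ (2 * l + 1) ^ n := by exact_mod_cast hcard n
    rw [mul_div_assoc', div_le_iff₀ (by positivity), mul_comm]
    gcongr

lemma log_div_log_lt_one (l : ℕ) : Real.log (2 * l + 1) / Real.log (2 * l + 2) < 1 := by
  have hl : (0 : ℝ) ≤ l := l.cast_nonneg
  rw [div_lt_one (Real.log_pos (by linarith))]
  exact Real.log_lt_log (by linarith) (by linarith)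

lemma frontier_Kl_subset (l : ℕ) : frontier (Kl l) ⊆ tileInter l 1 ∪ tileInter l (-1) := by
  intro x hx
  have hxK : x ∈ Kl l := (isCompact_Kl l).isClosed.frontier_subset hx
  rw [frontier_eq_closure_inter_closure] at hx
  have hsub : (Kl l)ᶜ ⊆ Kl l + ((↑) : ℤ → ℝ) '' {0}ᶜ := by
    intro y hy
    obtain ⟨a, ha, _, ⟨n, -, rfl⟩, rfl⟩ := (Kl_add_int_eq_univ l).symm ▸ mem_univ y
    refine ⟨a, ha, _, ⟨n, ?_, rfl⟩, rfl⟩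
    rintro rfl
    exact hy (by simpa using ha)
  obtain ⟨a, ha, _, ⟨n, hn, rfl⟩, rfl⟩ :=
    closure_minimal hsub (isClosed_Kl_add_intCast l _) hx.2
  have b1 := Kl_subset_Icc l ha
  have b2 := Kl_subset_Icc l hxK
  have hl : (0 : ℝ) < 1 / (2 * l + 1) := by positivity
  rw [Kl_diam_lt_two] at b1 b2
  have h1 : n < 2 := by
    have : (n : ℝ) < 2 := by linarith [b1.1, b2.2]
    exact_mod_cast this
  have h2 : -2 < n := by
    have : (-2 : ℝ) < n := by linarith [b1.2, b2.1]
    exact_mod_cast this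
  have hn' : n ≠ 0 := hn
  obtain rfl | rfl : n = 1 ∨ n = -1 := by omega
  · exact Or.inl ⟨hxK, by simpa using ha⟩
  · exact Or.inr ⟨hxK, by simpa using ha⟩

lemma one_le_dimH_Kl (l : ℕ) : 1 ≤ dimH (Kl l) := by
  have h : (univ : Set ℝ) ⊆ ⋃ n : ℤ, (fun x => x + (n : ℝ)) '' Kl l := by
    rw [← Kl_add_int_eq_univ l]
    rintro _ ⟨a, ha, _, ⟨n, -, rfl⟩, rfl⟩
    exact mem_iUnion.2 ⟨n, a, ha, rfl⟩
  rw [← Real.dimH_univ]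
  refine (dimH_mono h).trans ?_
  rw [dimH_iUnion]
  exact iSup_le fun n => (isometry_add_right (n : ℝ)).dimH_image _ |>.le

/-- Every point of the tile has arbitrarily small scaled copies of the tile near it. -/
lemma exists_small_copy (l n : ℕ) {x : ℝ} (hx : x ∈ Kl l) :
    ∃ a : ℝ, ∀ y ∈ Kl l, (a + y) / (2 * l + 2) ^ n ∈ Kl l ∧
      |(a + y) / (2 * l + 2) ^ n - x| ≤ 2 / (2 * l + 2) ^ n := by
  induction n generalizing x with
  | zero =>
    refine ⟨0, fun y hy => ⟨by simpa using hy, ?_⟩⟩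
    have b1 := Kl_subset_Icc l hx
    have b2 := Kl_subset_Icc l hy
    have hl : (0 : ℝ) < 1 / (2 * l + 1) := by positivity
    rw [Kl_diam_lt_two] at b1 b2
    simp only [pow_zero, div_one, zero_add, abs_le]
    constructor <;> linarith [b1.1, b1.2, b2.1, b2.2]
  | succ n ih =>
    obtain ⟨d, hd, hz⟩ := exists_mul_sub_mem_Kl hx
    obtain ⟨a, ha⟩ := ih hz
    have hN : (0 : ℝ) < 2 * l + 2 := by positivity
    refine ⟨d * (2 * l + 2) ^ n + a, fun y hy => ?_⟩
    obtain ⟨h1, h2⟩ := ha y hy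
    have e : (d * (2 * l + 2) ^ n + a + y) / (2 * l + 2 : ℝ) ^ (n + 1)
        = (d + (a + y) / (2 * l + 2) ^ n) / (2 * l + 2) := by
      rw [pow_succ]; field_simp; ring
    refine ⟨e ▸ add_div_mem_Kl hd h1, ?_⟩
    have e2 : (d + (a + y) / (2 * l + 2) ^ n) / (2 * l + 2) - x
        = ((a + y) / (2 * l + 2) ^ n - ((2 * l + 2) * x - d)) / (2 * l + 2) := by
      field_simp; ring
    rw [e, e2, abs_div, abs_of_pos hN, pow_succ, ← div_div]
    gcongr

lemma tileInter_subset_frontier {l : ℕ} {k : ℤ} (hk : k = 1 ∨ k = -1) :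
    tileInter l k ⊆ frontier (Kl l) := by
  have hl : (0 : ℝ) ≤ l := l.cast_nonneg
  intro x hx
  refine ⟨subset_closure hx.1, fun hint => ?_⟩
  obtain ⟨δ, hδ, hball⟩ := Metric.mem_nhds_iff.1 (mem_interior_iff_mem_nhds.1 hint)
  obtain ⟨n, hn⟩ := exists_pow_lt_of_lt_one (half_pos hδ)
    (inv_lt_one_of_one_lt₀ (by linarith) : (2 * l + 2 : ℝ)⁻¹ < 1)
  rw [inv_pow] at hn
  obtain ⟨a, ha⟩ := exists_small_copy l n hx.2
  have hsub : Kl l ⊆ (fun z : ℝ => (2 * l + 2) ^ n * (z - k) - a) '' tileInter l k := by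
    intro y hy
    obtain ⟨h1, h2⟩ := ha y hy
    refine ⟨(a + y) / (2 * l + 2) ^ n + k, ⟨hball ?_, by simpa using h1⟩, ?_⟩
    · rw [Metric.mem_ball, Real.dist_eq]
      calc _ = |(a + y) / (2 * l + 2) ^ n - (x - k)| := by congr 1; ring
        _ ≤ 2 / (2 * l + 2) ^ n := h2
        _ < δ := by rw [div_eq_mul_inv]; linarith
    · simp only [add_sub_cancel_right]; field_simp; ring
  have hlip : LipschitzWith ((2 * l + 2) ^ n) (fun z : ℝ => (2 * l + 2) ^ n * (z - k) - a) := by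
    refine LipschitzWith.of_dist_le_mul fun z w => le_of_eq ?_
    rw [Real.dist_eq, Real.dist_eq, show (2 * l + 2 : ℝ) ^ n * (z - k) - a
      - ((2 * l + 2) ^ n * (w - k) - a) = (2 * l + 2) ^ n * (z - w) by ring, abs_mul,
      abs_of_pos (by positivity)]
    simp
  have h := (one_le_dimH_Kl l).trans ((dimH_mono hsub).trans
    ((hlip.dimH_image_le _).trans (dimH_tileInter_le hk)))
  rw [ENNReal.one_le_ofReal] at h
  exact absurd (log_div_log_lt_one l) h.not_gt

/-- The leading digit of the fractional part of `t` in base `2 * l + 1`. -/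
noncomputable def leadDigit (l : ℕ) (t : ℝ) : ℕ := ⌊(2 * l + 1) * Int.fract t⌋₊

/-- One step along the edge of the boundary graph selected by the leading digit of a real. -/
noncomputable def edgeStep (l : ℕ) (p : ℤ × ℝ) : ℤ × ℝ :=
  (nextState l p.1 (leadDigit l p.2), Int.fract ((2 * l + 1) * p.2))

/-- The sequence of digits read along the path in the boundary graph selected by a real. -/
noncomputable def pathDigits (l : ℕ) (p : ℤ × ℝ) (i : ℕ) : ℕ :=
  edgeDigit l ((edgeStep l)^[i] p).1 (leadDigit l ((edgeStep l)^[i] p).2)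

/-- The point of the tile with digits `pathDigits l (k, t)`. -/
noncomputable def pathPoint (l : ℕ) (k : ℤ) (t : ℝ) : ℝ := digitExpansion l (pathDigits l (k, t))

lemma leadDigit_lt (l : ℕ) (t : ℝ) : leadDigit l t < 2 * l + 1 := by
  have h0 := Int.fract_nonneg t
  rw [leadDigit, Nat.floor_lt (by positivity)]
  push_cast
  nlinarith [Int.fract_lt_one t, (l.cast_nonneg : (0 : ℝ) ≤ l)]

lemma leadDigit_add_fract (l : ℕ) {t : ℝ} (ht : t ∈ Ico (0 : ℝ) 1) :
    (2 * l + 1) * t = leadDigit l t + Int.fract ((2 * l + 1) * t) := by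
  have h0 := ht.1
  rw [leadDigit, Int.fract_eq_self.2 ht, natCast_floor_eq_intCast_floor (by positivity),
    Int.floor_add_fract]

lemma pathDigits_mem (l : ℕ) (p : ℤ × ℝ) (i : ℕ) : pathDigits l p i ∈ Tl l :=
  edgeDigit_mem_Tl _ (leadDigit_lt _ _)

lemma pathPoint_mem_Kl (l : ℕ) (k : ℤ) (t : ℝ) : pathPoint l k t ∈ Kl l :=
  ⟨_, pathDigits_mem l _, rfl⟩

lemma pathPoint_eq (l : ℕ) (k : ℤ) (t : ℝ) :
    (2 * l + 2) * pathPoint l k t = edgeDigit l k (leadDigit l t)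
      + pathPoint l (nextState l k (leadDigit l t)) (Int.fract ((2 * l + 1) * t)) := by
  have hl : (0 : ℝ) ≤ l := l.cast_nonneg
  have h := digitExpansion_shift (pathDigits_mem l (k, t))
  rw [pathPoint, h, mul_div_cancel₀ _ (by positivity)]
  rfl

lemma abs_pathPoint_sub_le (l n : ℕ) {k : ℤ} (hk : k = 1 ∨ k = -1) (t : ℝ) :
    |pathPoint l k t - pathPoint l (-k) t - k| ≤ 3 * ((2 * l + 2 : ℝ)⁻¹) ^ n := by
  have hl : (0 : ℝ) ≤ l := l.cast_nonneg
  induction n generalizing k t with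
  | zero =>
    have b1 := Kl_subset_Icc l (pathPoint_mem_Kl l k t)
    have b2 := Kl_subset_Icc l (pathPoint_mem_Kl l (-k) t)
    have hl : (0 : ℝ) < 1 / (2 * l + 1) := by positivity
    rw [Kl_diam_lt_two] at b1 b2
    rw [abs_le]
    rcases hk with rfl | rfl <;> push_cast at * <;>
      constructor <;> linarith [b1.1, b1.2, b2.1, b2.2]
  | succ n ih =>
    have h := ih (nextState_eq_or (l := l) hk (leadDigit l t)) (Int.fract ((2 * l + 1) * t))
    have e1 := pathPoint_eq l k t
    have e2 := pathPoint_eq l (-k) t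
    have e3 : ((edgeDigit l k (leadDigit l t) : ℤ) : ℝ) - (edgeDigit l (-k) (leadDigit l t) : ℤ)
        = (2 * l + 2) * k - nextState l k (leadDigit l t) := by
      exact_mod_cast edgeDigit_sub_edgeDigit_neg hk (leadDigit l t)
    rw [nextState_neg] at e2
    push_cast at e3
    have hN : (0 : ℝ) < 2 * l + 2 := by positivity
    have e : (2 * l + 2) * (pathPoint l k t - pathPoint l (-k) t - k)
        = pathPoint l (nextState l k (leadDigit l t)) (Int.fract ((2 * l + 1) * t))
          - pathPoint l (-nextState l k (leadDigit l t)) (Int.fract ((2 * l + 1) * t))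
          - nextState l k (leadDigit l t) := by linarith
    rw [← e, abs_mul, abs_of_pos hN] at h
    rw [pow_succ, ← mul_assoc, ← div_eq_mul_inv, le_div_iff₀ hN]
    linarith

lemma pathPoint_mem_tileInter (l : ℕ) {k : ℤ} (hk : k = 1 ∨ k = -1) (t : ℝ) :
    pathPoint l k t ∈ tileInter l k := by
  have hl : (0 : ℝ) ≤ l := l.cast_nonneg
  refine ⟨pathPoint_mem_Kl l k t, ?_⟩
  have hlim := (tendsto_pow_atTop_nhds_zero_of_lt_one (by positivity)
    (inv_lt_one_of_one_lt₀ (by linarith) : (2 * l + 2 : ℝ)⁻¹ < 1)).const_mul 3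
  have h := ge_of_tendsto' hlim fun n => abs_pathPoint_sub_le l n hk t
  rw [mul_zero, abs_nonpos_iff] at h
  rw [show pathPoint l k t - k = pathPoint l (-k) t by linarith]
  exact pathPoint_mem_Kl l (-k) t

lemma edge_separated {l j j' : ℕ} {k : ℤ} (hk : k = 1 ∨ k = -1) (hj : j < 2 * l + 1)
    (hj' : j' < 2 * l + 1) (hne : j ≠ j') {y y' : ℝ} (hy : y ∈ tileInter l (nextState l k j))
    (hy' : y' ∈ tileInter l (nextState l k j')) :
    1 / (2 * l + 1) ≤ |(edgeDigit l k j + y) - (edgeDigit l k j' + y')| := by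
  wlog hle : edgeDigit l k j' ≤ edgeDigit l k j generalizing j j' y y'
  · rw [abs_sub_comm]
    exact this hj' hj hne.symm hy' hy (by omega)
  have b1 := Kl_subset_Icc l hy.1
  have b2 := Kl_subset_Icc l hy'.1
  have b3 := Kl_subset_Icc l hy.2
  have b4 := Kl_subset_Icc l hy'.2
  rw [Kl_diam_lt_two] at b1 b2 b3 b4
  rcases hle.eq_or_lt with heq | hlt
  · have hopp : (nextState l k j = 1 ∧ nextState l k j' = -1) ∨
        (nextState l k j = -1 ∧ nextState l k j' = 1) := by
      unfold edgeDigit at heq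
      unfold nextState
      rcases hk with rfl | rfl <;> split_ifs at * <;> omega
    rw [heq, add_sub_add_left_eq_sub]
    rcases hopp with ⟨h1, h2⟩ | ⟨h1, h2⟩
    · rw [h1] at b3; rw [h2] at b4
      push_cast at b3 b4
      exact le_trans (by linarith [b3.1, b4.2]) (le_abs_self _)
    · rw [h1] at b3; rw [h2] at b4
      push_cast at b3 b4
      exact le_trans (by linarith [b3.2, b4.1]) (neg_le_abs _)
  · have h2 : edgeDigit l k j' + 2 ≤ edgeDigit l k j := by
      unfold edgeDigit at hlt ⊢
      split_ifs at * <;> omega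
    have h2' : (edgeDigit l k j' : ℝ) + 2 ≤ edgeDigit l k j := by exact_mod_cast h2
    exact le_trans (by linarith [b1.1, b2.2]) (le_abs_self _)

lemma abs_sub_le_of_pathPoint_near (l n : ℕ) {k : ℤ} (hk : k = 1 ∨ k = -1) {t t' : ℝ}
    (ht : t ∈ Ico (0 : ℝ) 1) (ht' : t' ∈ Ico (0 : ℝ) 1)
    (h : (2 * l + 1) * (2 * l + 2) ^ n * |pathPoint l k t - pathPoint l k t'| < 1) :
    (2 * l + 1) ^ n * |t - t'| ≤ 1 := by
  have hl : (0 : ℝ) ≤ l := l.cast_nonneg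
  induction n generalizing k t t' with
  | zero =>
    rw [pow_zero, one_mul, abs_le]
    constructor <;> linarith [ht.1, ht.2, ht'.1, ht'.2]
  | succ n ih =>
    have e1 := pathPoint_eq l k t
    have e2 := pathPoint_eq l k t'
    have hN : (0 : ℝ) < 2 * l + 2 := by positivity
    have hscale : (2 * l + 2) * |pathPoint l k t - pathPoint l k t'|
        = |(2 * l + 2) * pathPoint l k t - (2 * l + 2) * pathPoint l k t'| := by
      rw [← mul_sub, abs_mul, abs_of_pos hN]
    have h' : (2 * l + 1) * (2 * l + 2) ^ n
        * |(2 * l + 2) * pathPoint l k t - (2 * l + 2) * pathPoint l k t'| < 1 := by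
      rw [← hscale]; refine lt_of_eq_of_lt ?_ h; ring
    rw [e1, e2] at h'
    by_cases hne : leadDigit l t = leadDigit l t'
    · rw [hne, add_sub_add_left_eq_sub] at h'
      have := ih (nextState_eq_or hk _) ⟨Int.fract_nonneg _, Int.fract_lt_one _⟩
        ⟨Int.fract_nonneg _, Int.fract_lt_one _⟩ h'
      have f1 := leadDigit_add_fract l ht
      have f2 := leadDigit_add_fract l ht'
      rw [hne] at f1
      rw [show Int.fract ((2 * l + 1) * t) - Int.fract ((2 * l + 1) * t')
        = (2 * l + 1) * (t - t') by linarith, abs_mul, abs_of_pos (by positivity),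
        ← mul_assoc, ← pow_succ] at this
      exact this
    · have hsep := edge_separated hk (leadDigit_lt l t) (leadDigit_lt l t') hne
        (pathPoint_mem_tileInter l (nextState_eq_or hk _) (Int.fract ((2 * l + 1) * t)))
        (pathPoint_mem_tileInter l (nextState_eq_or hk _) (Int.fract ((2 * l + 1) * t')))
      rw [div_le_iff₀ (by positivity)] at hsep
      have hp : (1 : ℝ) ≤ (2 * l + 2) ^ n := one_le_pow₀ (by linarith)
      nlinarith

lemma abs_sub_le_rpow_pathPoint {l : ℕ} (hl : 1 ≤ l) {k : ℤ} (hk : k = 1 ∨ k = -1) {t t' : ℝ}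
    (ht : t ∈ Ico (0 : ℝ) 1) (ht' : t' ∈ Ico (0 : ℝ) 1) :
    |t - t'| ≤ ((2 * l + 1) * (2 * l + 2) * |pathPoint l k t - pathPoint l k t'|)
      ^ (Real.log (2 * l + 1) / Real.log (2 * l + 2)) := by
  classical
  have hl' : (1 : ℝ) ≤ l := by exact_mod_cast hl
  set s := Real.log (2 * l + 1) / Real.log (2 * l + 2) with hs
  have hs0 : 0 ≤ s := div_nonneg (Real.log_nonneg (by linarith)) (Real.log_nonneg (by linarith))
  have hle_one : |t - t'| ≤ 1 := by
    rw [abs_le]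
    constructor <;> linarith [ht.1, ht.2, ht'.1, ht'.2]
  have hnear := fun n => abs_sub_le_of_pathPoint_near l n hk ht ht'
  set δ := |pathPoint l k t - pathPoint l k t'| with hδ
  rcases (abs_nonneg _ : 0 ≤ δ).eq_or_lt with h0 | hpos
  · rcases eq_or_ne t t' with rfl | hne
    · rw [sub_self, abs_zero]; positivity
    · obtain ⟨n, hn⟩ := pow_unbounded_of_one_lt |t - t'|⁻¹ (by linarith : (1 : ℝ) < 2 * l + 1)
      have h := hnear n (by rw [hδ, ← h0]; norm_num)
      rw [inv_lt_iff_one_lt_mul₀ (abs_pos.2 (sub_ne_zero.2 hne))] at hn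
      linarith
  have hex : ∃ n : ℕ, 1 ≤ (2 * l + 1) * (2 * l + 2) ^ n * δ := by
    obtain ⟨n, hn⟩ := pow_unbounded_of_one_lt ((2 * l + 1) * δ)⁻¹
      (by linarith : (1 : ℝ) < 2 * l + 2)
    rw [inv_lt_iff_one_lt_mul₀ (by positivity)] at hn
    exact ⟨n, by linarith⟩
  have hfind := Nat.find_spec hex
  rcases hm : Nat.find hex with _ | m
  · rw [hm] at hfind
    refine hle_one.trans (Real.one_le_rpow ?_ hs0)
    have : 0 ≤ (2 * l + 1) * δ := by positivity
    nlinarith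
  · rw [hm] at hfind
    have hlt := hnear m (not_le.1 (Nat.find_min hex (by omega)))
    refine le_of_mul_le_mul_left ?_ (by positivity : (0 : ℝ) < (2 * l + 1) ^ m)
    rw [← pow_rpow_log_div_log m, ← Real.mul_rpow (by positivity) (by positivity),
      pow_rpow_log_div_log m]
    refine hlt.trans (Real.one_le_rpow (hfind.trans_eq ?_) hs0)
    ring

lemma le_dimH_tileInter {l : ℕ} (hl : 1 ≤ l) {k : ℤ} (hk : k = 1 ∨ k = -1) :
    ENNReal.ofReal (Real.log (2 * l + 1) / Real.log (2 * l + 2)) ≤ dimH (tileInter l k) := by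
  have hl' : (1 : ℝ) ≤ l := by exact_mod_cast hl
  have hbound := fun t ht t' ht' => @abs_sub_le_rpow_pathPoint l hl k hk t t' ht ht'
  set s := Real.log (2 * l + 1) / Real.log (2 * l + 2) with hs
  have hs0 : 0 < s := div_pos (Real.log_pos (by linarith)) (Real.log_pos (by linarith))
  set I := Ico (0 : ℝ) 1
  have hinj : InjOn (pathPoint l k) I := by
    intro t ht t' ht' h
    have := hbound t ht t' ht'
    rw [h, sub_self, abs_zero, mul_zero, Real.zero_rpow hs0.ne', abs_nonpos_iff] at this
    linarith
  have hinv := hinj.leftInvOn_invFunOn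
  set C : ℝ := ((2 * l + 1) * (2 * l + 2)) ^ s with hC
  have hholder : HolderOnWith C.toNNReal s.toNNReal (Function.invFunOn (pathPoint l k) I)
      (pathPoint l k '' I) := by
    rintro _ ⟨t, ht, rfl⟩ _ ⟨t', ht', rfl⟩
    rw [hinv ht, hinv ht', edist_dist, edist_dist, Real.coe_toNNReal _ hs0.le,
      ENNReal.ofReal_rpow_of_nonneg dist_nonneg hs0.le, ← ENNReal.ofReal,
      ← ENNReal.ofReal_mul (by positivity), Real.dist_eq, Real.dist_eq, hC,
      ← Real.mul_rpow (by positivity) (by positivity)]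
    exact ENNReal.ofReal_le_ofReal (hbound t ht t' ht')
  have hdim := hholder.dimH_image_le (Real.toNNReal_pos.2 hs0)
  rw [hinv.image_image] at hdim
  have hI : dimH I = 1 := by
    rw [Real.dimH_of_nonempty_interior (by simp [I])]; simp
  rw [hI, ENNReal.le_div_iff_mul_le (by simp [hs0]) (by simp), one_mul] at hdim
  refine hdim.trans (dimH_mono ?_)
  rintro _ ⟨t, -, rfl⟩
  exact pathPoint_mem_tileInter l hk t

theorem stmt15 (l : ℕ) (hl : 1 ≤ l) :
    dimH (frontier (Kl l)) =
      ENNReal.ofReal (Real.log (2 * l + 1) / Real.log (2 * l + 2)) := by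
  refine le_antisymm ?_ ?_
  · refine (dimH_mono (frontier_Kl_subset l)).trans ?_
    rw [dimH_union]
    exact max_le (dimH_tileInter_le (Or.inl rfl)) (dimH_tileInter_le (Or.inr rfl))
  · exact (le_dimH_tileInter hl (Or.inl rfl)).trans
      (dimH_mono (tileInter_subset_frontier (Or.inl rfl)))
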